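/- arXiv:1801.09565 — 2 statements merged into one kernel-verified Lean document; each statement's English description precedes it below -/
import Mathlib

section
/- Let u : ℝ² → ℝ² be smooth, compactly supported and divergence-free and let θ : ℝ² → ℝ² be smooth and compactly supported. Then Σ_{k=1}^{2} ∫_{ℝ²} (Σ_{i=1}^{2} u_i(x) ∂_i θ_k(x)) (−Δθ_k(x) + f(θ(x))_k) dx = Σ_{i,j,k=1}^{2} ∫_{ℝ²} ∂_i θ_k(x) ∂_j θ_k(x) ∂_j u_i(x) dx, where Δθ_k = ∂₁₁θ_k + ∂₂₂θ_k. -/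
open MeasureTheory

noncomputable section

/-- Partial derivative of a real-valued function on `ℝ²` in the `i`-th coordinate direction. -/
def pderivE (g : (Fin 2 → ℝ) → ℝ) (i : Fin 2) (x : Fin 2 → ℝ) : ℝ :=
  fderiv ℝ g x (Pi.single i 1)

/-- The Navier–Stokes trilinear form
`b(u,v,w) = ∑ i j, ∫ u_i ∂_i v_j w_j`. -/
def formB (u v w : (Fin 2 → ℝ) → (Fin 2 → ℝ)) : ℝ :=
  ∑ i : Fin 2, ∑ j : Fin 2, ∫ x : Fin 2 → ℝ, u x i * pderivE (fun y => v y j) i x * w x j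

/-- The Ericksen stress trilinear form
`m(θ₁,θ₂,u) = −∑ i j k, ∫ ∂_i θ₁^k ∂_j θ₂^k ∂_j u^i`. -/
def formM (t1 t2 u : (Fin 2 → ℝ) → (Fin 2 → ℝ)) : ℝ :=
  -∑ i : Fin 2, ∑ j : Fin 2, ∑ k : Fin 2, ∫ x : Fin 2 → ℝ,
    pderivE (fun y => t1 y k) i x * pderivE (fun y => t2 y k) j x *
      pderivE (fun y => u y i) j x

/-- `u` is divergence-free: `∂₁u₁ + ∂₂u₂ = 0` everywhere. -/
def DivergenceFree (u : (Fin 2 → ℝ) → (Fin 2 → ℝ)) : Prop :=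
  ∀ x, (∑ i : Fin 2, pderivE (fun y => u y i) i x) = 0

/-- The `L²` norm of an `ℝ²`-valued map. -/
def l2norm (g : (Fin 2 → ℝ) → (Fin 2 → ℝ)) : ℝ :=
  (∫ x : Fin 2 → ℝ, ∑ k : Fin 2, (g x k) ^ 2) ^ (1/2 : ℝ)

/-- The `L²` norm of the gradient of an `ℝ²`-valued map. -/
def gradNorm (g : (Fin 2 → ℝ) → (Fin 2 → ℝ)) : ℝ :=
  (∫ x : Fin 2 → ℝ, ∑ i : Fin 2, ∑ k : Fin 2, (pderivE (fun y => g y k) i x) ^ 2) ^ (1/2 : ℝ)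

/-- The `L²` norm of a real-valued function. -/
def l2normR (g : (Fin 2 → ℝ) → ℝ) : ℝ :=
  (∫ x : Fin 2 → ℝ, (g x) ^ 2) ^ (1/2 : ℝ)

/-- The `L²` norm of the gradient of a real-valued function. -/
def gradNormR (g : (Fin 2 → ℝ) → ℝ) : ℝ :=
  (∫ x : Fin 2 → ℝ, ∑ i : Fin 2, (pderivE g i x) ^ 2) ^ (1/2 : ℝ)

/-- The `k`-th component of the (componentwise) Laplacian `Δg_k = ∂₁₁ g_k + ∂₂₂ g_k`. -/
def lapComp (g : (Fin 2 → ℝ) → (Fin 2 → ℝ)) (k : Fin 2) (x : Fin 2 → ℝ) : ℝ :=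
  ∑ i : Fin 2, pderivE (pderivE (fun y => g y k) i) i x

/-- The `L²` norm of the componentwise Laplacian. -/
def lapNorm (g : (Fin 2 → ℝ) → (Fin 2 → ℝ)) : ℝ :=
  (∫ x : Fin 2 → ℝ, ∑ k : Fin 2, (lapComp g k x) ^ 2) ^ (1/2 : ℝ)

/-- The `L^{4N+2}` norm of an `ℝ²`-valued map (written using `|v|^{4N+2} = (|v|²)^{2N+1}`). -/
def lqNorm (N : ℕ) (g : (Fin 2 → ℝ) → (Fin 2 → ℝ)) : ℝ :=
  (∫ x : Fin 2 → ℝ, (∑ k : Fin 2, (g x k) ^ 2) ^ (2 * N + 1)) ^ (1 / (4 * (N:ℝ) + 2))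

/-- The polynomial nonlinearity `f(θ) = (∑_{j=0}^{N} b_j |θ|^{2j}) θ`. -/
def polyF (N : ℕ) (b : Fin (N + 1) → ℝ) (v : Fin 2 → ℝ) : Fin 2 → ℝ :=
  fun k => (∑ j : Fin (N + 1), b j * (∑ l : Fin 2, (v l) ^ 2) ^ (j : ℕ)) * v k

lemma ContDiff.pderivE {g : (Fin 2 → ℝ) → ℝ} (hg : ContDiff ℝ (⊤ : ℕ∞) g) (i : Fin 2) :
    ContDiff ℝ (⊤ : ℕ∞) (pderivE g i) :=
  (hg.fderiv_right (m := (⊤ : ℕ∞)) (by simp)).clm_apply contDiff_const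

lemma pderivE_mul {f g : (Fin 2 → ℝ) → ℝ} (hf : Differentiable ℝ f) (hg : Differentiable ℝ g)
    (i : Fin 2) (x : Fin 2 → ℝ) :
    pderivE (fun y => f y * g y) i x = pderivE f i x * g x + f x * pderivE g i x := by
  simp only [pderivE]
  rw [fderiv_fun_mul (hf x) (hg x)]
  simp
  ring

lemma pderivE_add {f g : (Fin 2 → ℝ) → ℝ} (hf : Differentiable ℝ f) (hg : Differentiable ℝ g)
    (i : Fin 2) (x : Fin 2 → ℝ) :
    pderivE (fun y => f y + g y) i x = pderivE f i x + pderivE g i x := by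
  simp only [pderivE]
  rw [fderiv_fun_add (hf x) (hg x)]
  simp

lemma pderivE_sub {f g : (Fin 2 → ℝ) → ℝ} (hf : Differentiable ℝ f) (hg : Differentiable ℝ g)
    (i : Fin 2) (x : Fin 2 → ℝ) :
    pderivE (fun y => f y - g y) i x = pderivE f i x - pderivE g i x := by
  simp only [pderivE]
  rw [fderiv_fun_sub (hf x) (hg x)]
  simp

lemma pderivE_sum {ι : Type*} (s : Finset ι) {f : ι → (Fin 2 → ℝ) → ℝ}
    (hf : ∀ k ∈ s, Differentiable ℝ (f k)) (i : Fin 2) (x : Fin 2 → ℝ) :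
    pderivE (fun y => ∑ k ∈ s, f k y) i x = ∑ k ∈ s, pderivE (f k) i x := by
  simp only [pderivE]
  rw [fderiv_fun_sum fun k hk => hf k hk x]
  simp

lemma pderivE_const_mul (c : ℝ) {f : (Fin 2 → ℝ) → ℝ} (hf : Differentiable ℝ f)
    (i : Fin 2) (x : Fin 2 → ℝ) :
    pderivE (fun y => c * f y) i x = c * pderivE f i x := by
  simp only [pderivE]
  rw [fderiv_const_mul (hf x)]
  simp

lemma pderivE_pow {f : (Fin 2 → ℝ) → ℝ} (hf : Differentiable ℝ f) (n : ℕ)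
    (i : Fin 2) (x : Fin 2 → ℝ) :
    pderivE (fun y => f y ^ n) i x = n * f x ^ (n - 1) * pderivE f i x := by
  simp only [pderivE]
  rw [fderiv_fun_pow n (hf x)]
  simp

lemma pderivE_comm {g : (Fin 2 → ℝ) → ℝ} (hg : ContDiff ℝ (⊤ : ℕ∞) g) (i j : Fin 2)
    (x : Fin 2 → ℝ) : pderivE (pderivE g i) j x = pderivE (pderivE g j) i x := by
  have hd : DifferentiableAt ℝ (fderiv ℝ g) x :=
    (hg.fderiv_right (m := (⊤ : ℕ∞)) (by simp)).differentiable (by simp) x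
  have key (k l : Fin 2) : pderivE (pderivE g k) l x =
      fderiv ℝ (fderiv ℝ g) x (Pi.single l 1) (Pi.single k 1) := by
    change fderiv ℝ (fun y => fderiv ℝ g y (Pi.single k 1)) x (Pi.single l 1) = _
    rw [fderiv_clm_apply hd (by fun_prop)]
    simp
  rw [key, key]
  exact (hg.contDiffAt.isSymmSndFDerivAt (by
    simpa using! WithTop.coe_le_coe.2 (le_top : (2 : ℕ∞) ≤ ⊤))) _ _

lemma HasCompactSupport.pderivE {g : (Fin 2 → ℝ) → ℝ} (hs : HasCompactSupport g) (i : Fin 2) :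
    HasCompactSupport (pderivE g i) :=
  hs.fderiv_apply ℝ (Pi.single i 1)

/-- A compactly supported partial derivative has vanishing integral. -/
lemma integral_pderivE_eq_zero {g : (Fin 2 → ℝ) → ℝ} (hg : ContDiff ℝ (⊤ : ℕ∞) g)
    (hs : HasCompactSupport g) (i : Fin 2) : ∫ x, pderivE g i x = 0 := by
  have h1 : Integrable (pderivE g i) :=
    (hg.pderivE i).continuous.integrable_of_hasCompactSupport (hs.pderivE i)
  have h2 : Integrable g := hg.continuous.integrable_of_hasCompactSupport hs
  have := integral_mul_fderiv_eq_neg_fderiv_mul_of_integrable (μ := volume)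
    (f := fun _ : Fin 2 → ℝ => (1 : ℝ)) (g := g) (v := Pi.single i 1)
    (by simp) (by simpa using! h1) (by simpa using h2) (by simp)
    (fun x _ => hg.differentiable (by simp) x)
  simpa using! this

/-- The potential `F(v) = ∑_j b_j |v|^{2(j+1)} / (2(j+1))`, whose gradient is `polyF N b`. -/
def polyPot (N : ℕ) (b : Fin (N + 1) → ℝ) (v : Fin 2 → ℝ) : ℝ :=
  ∑ j : Fin (N + 1), b j / (2 * ((j : ℕ) + 1)) * (∑ l : Fin 2, (v l) ^ 2) ^ ((j : ℕ) + 1)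

lemma contDiff_polyPot (N : ℕ) (b : Fin (N + 1) → ℝ) : ContDiff ℝ (⊤ : ℕ∞) (polyPot N b) := by
  unfold polyPot
  fun_prop

lemma pderivE_polyPot_comp (N : ℕ) (b : Fin (N + 1) → ℝ) {θ : (Fin 2 → ℝ) → (Fin 2 → ℝ)}
    (hθ : ∀ k, Differentiable ℝ fun y => θ y k) (i : Fin 2) (x : Fin 2 → ℝ) :
    pderivE (fun y => polyPot N b (θ y)) i x =
      ∑ k, polyF N b (θ x) k * pderivE (fun y => θ y k) i x := by
  have hsq : Differentiable ℝ fun y => ∑ l : Fin 2, (θ y l) ^ 2 := by fun_prop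
  have hdsq : pderivE (fun y => ∑ l : Fin 2, (θ y l) ^ 2) i x =
      2 * ∑ k, θ x k * pderivE (fun y => θ y k) i x := by
    rw [pderivE_sum _ fun k _ => (hθ k).fun_pow 2, Finset.mul_sum]
    refine Finset.sum_congr rfl fun k _ => ?_
    rw [pderivE_pow (hθ k)]
    norm_num
    ring
  unfold polyPot polyF
  rw [pderivE_sum _ fun j _ => (hsq.fun_pow _).const_mul _]
  simp_rw [mul_assoc, ← Finset.mul_sum, Finset.sum_mul]
  refine Finset.sum_congr rfl fun j _ => ?_
  rw [pderivE_const_mul _ (hsq.fun_pow _), pderivE_pow hsq, hdsq]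
  have : ((j : ℕ) : ℝ) + 1 ≠ 0 := by positivity
  push_cast
  field_simp

/-- The `j`-th component `u_j (|∇θ|² / 2 + F(θ)) − ∑_{i,k} u_i ∂_i θ_k ∂_j θ_k` of the
energy flux. -/
def energyFlux (N : ℕ) (b : Fin (N + 1) → ℝ) (u θ : (Fin 2 → ℝ) → (Fin 2 → ℝ)) (j : Fin 2)
    (x : Fin 2 → ℝ) : ℝ :=
  u x j * (∑ i, ∑ k, (1 / 2) * pderivE (fun y => θ y k) i x ^ 2 + polyPot N b (θ x)) -
    ∑ i, u x i * ∑ k, pderivE (fun y => θ y k) i x * pderivE (fun y => θ y k) j x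

lemma contDiff_energyFlux (N : ℕ) (b : Fin (N + 1) → ℝ) {u θ : (Fin 2 → ℝ) → (Fin 2 → ℝ)}
    (hu : ContDiff ℝ (⊤ : ℕ∞) u) (hθ : ContDiff ℝ (⊤ : ℕ∞) θ) (j : Fin 2) :
    ContDiff ℝ (⊤ : ℕ∞) (energyFlux N b u θ j) := by
  have hU (i : Fin 2) : ContDiff ℝ (⊤ : ℕ∞) fun y => u y i := by fun_prop
  have hP (i k : Fin 2) : ContDiff ℝ (⊤ : ℕ∞) (pderivE (fun y => θ y k) i) :=
    ContDiff.pderivE (by fun_prop) i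
  have hF : ContDiff ℝ (⊤ : ℕ∞) fun y => polyPot N b (θ y) := (contDiff_polyPot N b).comp hθ
  unfold energyFlux
  fun_prop

lemma hasCompactSupport_energyFlux (N : ℕ) (b : Fin (N + 1) → ℝ)
    {u : (Fin 2 → ℝ) → (Fin 2 → ℝ)} (hus : HasCompactSupport u)
    (θ : (Fin 2 → ℝ) → (Fin 2 → ℝ)) (j : Fin 2) :
    HasCompactSupport (energyFlux N b u θ j) := by
  refine hus.mono fun x hx hux => hx ?_
  simp [energyFlux, hux]

/-- The divergence of the energy flux is the difference of the two energy densities. -/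
lemma sum_pderivE_energyFlux (N : ℕ) (b : Fin (N + 1) → ℝ) {u θ : (Fin 2 → ℝ) → (Fin 2 → ℝ)}
    (hu : ContDiff ℝ (⊤ : ℕ∞) u) (hdiv : DivergenceFree u) (hθ : ContDiff ℝ (⊤ : ℕ∞) θ)
    (x : Fin 2 → ℝ) :
    ∑ j, pderivE (energyFlux N b u θ j) j x =
      (∑ k : Fin 2, (∑ i : Fin 2, u x i * pderivE (fun y => θ y k) i x) *
          (- lapComp θ k x + polyF N b (θ x) k)) -
      ∑ i : Fin 2, ∑ j : Fin 2, ∑ k : Fin 2,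
        pderivE (fun y => θ y k) i x * pderivE (fun y => θ y k) j x *
          pderivE (fun y => u y i) j x := by
  have hT (k : Fin 2) : ContDiff ℝ (⊤ : ℕ∞) fun y => θ y k := by fun_prop
  have hU (i : Fin 2) : Differentiable ℝ fun y => u y i :=
    ContDiff.differentiable (n := (⊤ : ℕ∞)) (by fun_prop) (by simp)
  have hP (i k : Fin 2) : Differentiable ℝ (pderivE (fun y => θ y k) i) :=
    ((hT k).pderivE i).differentiable (by simp)
  have hF : Differentiable ℝ fun y => polyPot N b (θ y) :=
    ((contDiff_polyPot N b).comp hθ).differentiable (by simp)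
  have hdF := pderivE_polyPot_comp N b (fun k => (hT k).differentiable (by simp)) (x := x)
  have hE : Differentiable ℝ fun y => ∑ i, ∑ k, (1 / 2) * pderivE (fun z => θ z k) i y ^ 2 := by
    fun_prop
  have hdE (j : Fin 2) :
      pderivE (fun y => ∑ i, ∑ k, (1 / 2) * pderivE (fun z => θ z k) i y ^ 2) j x =
        ∑ i, ∑ k, pderivE (fun z => θ z k) i x * pderivE (pderivE (fun z => θ z k) i) j x := by
    rw [pderivE_sum _ fun i _ => by fun_prop]
    refine Finset.sum_congr rfl fun i _ => ?_
    rw [pderivE_sum _ fun k _ => by fun_prop]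
    refine Finset.sum_congr rfl fun k _ => ?_
    rw [pderivE_const_mul _ ((hP i k).fun_pow 2), pderivE_pow (hP i k)]
    norm_num
    ring
  have hQ (i j : Fin 2) : Differentiable ℝ fun y =>
      u y i * ∑ k, pderivE (fun z => θ z k) i y * pderivE (fun z => θ z k) j y := by
    fun_prop
  have hflux (j : Fin 2) : pderivE (energyFlux N b u θ j) j x =
      (pderivE (fun y => u y j) j x *
          (∑ i, ∑ k, (1 / 2) * pderivE (fun y => θ y k) i x ^ 2 + polyPot N b (θ x)) +
        u x j * (∑ i, ∑ k, pderivE (fun z => θ z k) i x *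
            pderivE (pderivE (fun z => θ z k) i) j x +
          ∑ k, polyF N b (θ x) k * pderivE (fun y => θ y k) j x)) -
      ∑ i, (pderivE (fun y => u y i) j x *
          (∑ k, pderivE (fun y => θ y k) i x * pderivE (fun y => θ y k) j x) +
        u x i * ∑ k, (pderivE (pderivE (fun z => θ z k) i) j x * pderivE (fun y => θ y k) j x +
          pderivE (fun y => θ y k) i x * pderivE (pderivE (fun z => θ z k) j) j x)) := by
    unfold energyFlux
    rw [pderivE_sub ((hU j).fun_mul (hE.fun_add hF)) (.fun_sum fun i _ => hQ i j),
      pderivE_mul (hU j) (hE.fun_add hF), pderivE_add hE hF, hdE, hdF,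
      pderivE_sum _ fun i _ => hQ i j]
    congr 1
    refine Finset.sum_congr rfl fun i _ => ?_
    rw [pderivE_mul (hU i) (by fun_prop), pderivE_sum _ fun k _ => by fun_prop]
    simp_rw [pderivE_mul (hP i _) (hP j _)]
  have hdx := hdiv x
  have hs (k : Fin 2) := pderivE_comm (hT k) 0 1 x
  simp only [hflux, lapComp, Fin.sum_univ_two] at hdx ⊢
  rw [hs 0, hs 1]
  linear_combination ((1 / 2) * (pderivE (fun y => θ y 0) 0 x ^ 2 +
    pderivE (fun y => θ y 1) 0 x ^ 2 + pderivE (fun y => θ y 0) 1 x ^ 2 +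
    pderivE (fun y => θ y 1) 1 x ^ 2) + polyPot N b (θ x)) * hdx

/-- the cancellation `⟨B̃(u,θ), −Δθ + f(θ)⟩ = −⟨M(θ), u⟩`, i.e.
`∑_k ∫ (∑_i u_i ∂_i θ_k)(−Δθ_k + f(θ)_k) = ∑_{i,j,k} ∫ ∂_i θ_k ∂_j θ_k ∂_j u_i`. -/
theorem convection_ericksen_cancellation (N : ℕ) (b : Fin (N + 1) → ℝ)
    (hb : ∀ j, 0 < b j)
    (u θ : (Fin 2 → ℝ) → (Fin 2 → ℝ))
    (hu : ContDiff ℝ (⊤ : ℕ∞) u) (hus : HasCompactSupport u) (hdiv : DivergenceFree u)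
    (hθ : ContDiff ℝ (⊤ : ℕ∞) θ) (hθs : HasCompactSupport θ) :
    (∑ k : Fin 2, ∫ x : Fin 2 → ℝ,
        (∑ i : Fin 2, u x i * pderivE (fun y => θ y k) i x) *
          (- lapComp θ k x + polyF N b (θ x) k)) =
      ∑ i : Fin 2, ∑ j : Fin 2, ∑ k : Fin 2, ∫ x : Fin 2 → ℝ,
        pderivE (fun y => θ y k) i x * pderivE (fun y => θ y k) j x *
          pderivE (fun y => u y i) j x := by
  have hT (k : Fin 2) : ContDiff ℝ (⊤ : ℕ∞) fun y => θ y k := by fun_prop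
  have hU (i : Fin 2) : ContDiff ℝ (⊤ : ℕ∞) fun y => u y i := by fun_prop
  have hUs (i : Fin 2) : HasCompactSupport fun y => u y i :=
    hus.comp_left (g := fun v : Fin 2 → ℝ => v i) rfl
  have cT (k : Fin 2) : Continuous fun y => θ y k := (hT k).continuous
  have cU (i : Fin 2) : Continuous fun y => u y i := (hU i).continuous
  have cP (i k : Fin 2) : Continuous (pderivE (fun y => θ y k) i) := ((hT k).pderivE i).continuous
  have cL (k : Fin 2) : Continuous (lapComp θ k) :=
    continuous_finsetSum _ fun i _ => (((hT k).pderivE i).pderivE i).continuous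
  have cF (k : Fin 2) : Continuous fun y => polyF N b (θ y) k := by
    unfold polyF
    fun_prop
  have hL (k : Fin 2) : Integrable fun x => (∑ i : Fin 2, u x i * pderivE (fun y => θ y k) i x) *
      (- lapComp θ k x + polyF N b (θ x) k) := by
    refine Continuous.integrable_of_hasCompactSupport (by fun_prop) ?_
    refine hus.mono fun x hx hux => hx ?_
    simp [hux]
  have hR (i j k : Fin 2) : Integrable fun x => pderivE (fun y => θ y k) i x *
      pderivE (fun y => θ y k) j x * pderivE (fun y => u y i) j x :=
    Continuous.integrable_of_hasCompactSupport
      (((cP i k).mul (cP j k)).mul ((hU i).pderivE j).continuous) ((hUs i).pderivE j).mul_left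
  have hW (j : Fin 2) : Integrable (pderivE (energyFlux N b u θ j) j) :=
    ((contDiff_energyFlux N b hu hθ j).pderivE j).continuous.integrable_of_hasCompactSupport
      ((hasCompactSupport_energyFlux N b hus θ j).pderivE j)
  have h0 : ∫ x, ∑ j, pderivE (energyFlux N b u θ j) j x = 0 := by
    rw [integral_finsetSum _ fun j _ => hW j]
    exact Finset.sum_eq_zero fun j _ => integral_pderivE_eq_zero
      (contDiff_energyFlux N b hu hθ j) (hasCompactSupport_energyFlux N b hus θ j) j
  simp_rw [sum_pderivE_energyFlux N b hu hdiv hθ] at h0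
  have hR1 (i j : Fin 2) := integrable_finsetSum Finset.univ fun k _ => hR i j k
  have hR2 (i : Fin 2) := integrable_finsetSum Finset.univ fun j _ => hR1 i j
  rw [integral_sub (integrable_finsetSum _ fun k _ => hL k)
    (integrable_finsetSum _ fun i _ => hR2 i), integral_finsetSum _ fun k _ => hL k,
    integral_finsetSum _ fun i _ => hR2 i] at h0
  simp_rw [integral_finsetSum _ fun j _ => hR1 _ j, integral_finsetSum _ fun k _ => hR _ _ k] at h0
  exact sub_eq_zero.mp h0

end
end

section
/- For every κ₂ > 0 there exist constants C₁(κ₂), C₂(κ₂) > 0, depending only on κ₂, N and the coefficients b₀,…,b_N, such that for all smooth compactly supported maps θ₁, θ₂ : ℝ² → ℝ², |∫_{ℝ²} (f(θ₁(x)) − f(θ₂(x)))·Δ(θ₁−θ₂)(x) dx| ≤ κ₂ ‖Δ(θ₁−θ₂)‖₂² + (C₁(κ₂) ‖∇(θ₁−θ₂)‖₂² + C₂(κ₂) ‖θ₁−θ₂‖₂²)(1 + ‖θ₁‖_{L^{4N+2}}^{2N} + ‖θ₂‖_{L^{4N+2}}^{2N})². -/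
open MeasureTheory

noncomputable section

lemma integral_mul_sq_le_of_hasCompactSupport {f g : (Fin 2 → ℝ) → ℝ}
    (hf : Continuous f) (hfs : HasCompactSupport f) (hf0 : ∀ x, 0 ≤ f x)
    (hg : Continuous g) (hgs : HasCompactSupport g) (hg0 : ∀ x, 0 ≤ g x) :
    (∫ x, f x * g x) ^ 2 ≤ (∫ x, f x ^ 2) * ∫ x, g x ^ 2 := by
  have h := integral_mul_le_Lp_mul_Lq_of_nonneg (μ := volume) Real.HolderConjugate.two_two
    (.of_forall hf0) (.of_forall hg0)
    (hf.memLp_of_hasCompactSupport hfs) (hg.memLp_of_hasCompactSupport hgs)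
  simp only [Real.rpow_two, ← Real.sqrt_eq_rpow] at h
  have hF : 0 ≤ ∫ x, f x ^ 2 := integral_nonneg fun x => sq_nonneg _
  have hG : 0 ≤ ∫ x, g x ^ 2 := integral_nonneg fun x => sq_nonneg _
  calc (∫ x, f x * g x) ^ 2
      ≤ (√(∫ x, f x ^ 2) * √(∫ x, g x ^ 2)) ^ 2 :=
        pow_le_pow_left₀ (integral_nonneg fun x => mul_nonneg (hf0 x) (hg0 x)) h 2
    _ = _ := by rw [mul_pow, Real.sq_sqrt hF, Real.sq_sqrt hG]

lemma integral_sq_le_sq_integral_norm_fderiv {u : (Fin 2 → ℝ) → ℝ}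
    (hu : ContDiff ℝ 1 u) (hus : HasCompactSupport u) :
    ∫ x, u x ^ 2 ≤ (∫ x, ‖fderiv ℝ u x‖) ^ 2 := by
  have hp : Real.HolderConjugate (Fintype.card (Fin 2) : ℝ) 2 := by
    rw [Fintype.card_fin]
    exact_mod_cast Real.HolderConjugate.two_two
  have h : ∫⁻ x, ‖u x‖ₑ ^ (2 : ℝ) ≤ (∫⁻ x, ‖fderiv ℝ u x‖ₑ) ^ (2 : ℝ) :=
    lintegral_pow_le_pow_lintegral_fderiv_aux hp hu hus
  have hint : Integrable (fderiv ℝ u) :=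
    Continuous.integrable_of_hasCompactSupport (hu.continuous_fderiv one_ne_zero)
      (hus.fderiv (𝕜 := ℝ))
  have hint2 : Integrable fun x => u x ^ 2 := by
    have hs : HasCompactSupport fun x => u x ^ 2 :=
      hus.comp_left (g := fun t : ℝ => t ^ 2) (zero_pow two_ne_zero)
    exact Continuous.integrable_of_hasCompactSupport (hu.continuous.pow 2) hs
  have h1 : ∫⁻ x, ‖u x‖ₑ ^ (2 : ℝ) = ENNReal.ofReal (∫ x, u x ^ 2) := by
    rw [ofReal_integral_eq_lintegral_ofReal hint2 (.of_forall fun x => sq_nonneg _)]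
    refine lintegral_congr fun x => ?_
    rw [ENNReal.rpow_two, Real.enorm_eq_ofReal_abs, ← ENNReal.ofReal_pow (abs_nonneg _), sq_abs]
  rw [h1, ← ofReal_integral_norm_eq_lintegral_enorm hint, ENNReal.rpow_two,
    ← ENNReal.ofReal_pow (integral_nonneg fun x => norm_nonneg _)] at h
  exact (ENNReal.ofReal_le_ofReal_iff (sq_nonneg _)).1 h

lemma norm_fderiv_sq_le_sum_pderivE_sq (u : (Fin 2 → ℝ) → ℝ) (x : Fin 2 → ℝ) :
    ‖fderiv ℝ u x‖ ^ 2 ≤ 2 * ∑ i : Fin 2, pderivE u i x ^ 2 := by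
  have h : ‖fderiv ℝ u x‖ ≤ |pderivE u 0 x| + |pderivE u 1 x| := by
    refine ContinuousLinearMap.opNorm_le_bound _ (by positivity) fun v => ?_
    have hv : v = v 0 • Pi.single 0 1 + v 1 • Pi.single 1 1 := by
      ext i; fin_cases i <;> simp
    have h0 := norm_le_pi_norm v 0
    have h1 := norm_le_pi_norm v 1
    rw [Real.norm_eq_abs] at h0 h1
    conv_lhs => rw [hv]
    rw [map_add, map_smul, map_smul, smul_eq_mul, smul_eq_mul]
    change ‖v 0 * pderivE u 0 x + v 1 * pderivE u 1 x‖ ≤ _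
    calc ‖v 0 * pderivE u 0 x + v 1 * pderivE u 1 x‖
        ≤ |v 0| * |pderivE u 0 x| + |v 1| * |pderivE u 1 x| := by
          rw [Real.norm_eq_abs, ← abs_mul, ← abs_mul]; exact abs_add_le _ _
      _ ≤ ‖v‖ * |pderivE u 0 x| + ‖v‖ * |pderivE u 1 x| := by gcongr
      _ = _ := by ring
  rw [Fin.sum_univ_two]
  calc ‖fderiv ℝ u x‖ ^ 2 ≤ (|pderivE u 0 x| + |pderivE u 1 x|) ^ 2 := by gcongr
    _ ≤ 2 * (|pderivE u 0 x| ^ 2 + |pderivE u 1 x| ^ 2) := add_sq_le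
    _ = _ := by rw [sq_abs, sq_abs]

/-- Iterated Gagliardo–Nirenberg inequality on the plane for even exponents. -/
lemma integral_pow_even_le {u : (Fin 2 → ℝ) → ℝ}
    (hu : ContDiff ℝ 1 u) (hus : HasCompactSupport u) (m : ℕ) :
    ∫ x, (u x ^ 2) ^ (m + 1) ≤
      ((m + 1).factorial : ℝ) ^ 2 * (∫ x, u x ^ 2) * (∫ x, ‖fderiv ℝ u x‖ ^ 2) ^ m := by
  have hcf := hu.continuous_fderiv (by norm_num)
  induction m with
  | zero => simp
  | succ m ih =>
    have hsob := integral_sq_le_sq_integral_norm_fderiv (hu.pow (m + 2))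
      (hus.comp_left (g := fun t : ℝ => t ^ (m + 2)) (by simp))
    have hfd : ∀ x, ‖fderiv ℝ (fun y => u y ^ (m + 2)) x‖ =
        (m + 2 : ℝ) * (|u x| ^ (m + 1) * ‖fderiv ℝ u x‖) := fun x => by
      rw [fderiv_fun_pow (m + 2) (hu.differentiable (by norm_num) x), norm_smul]
      simp only [nsmul_eq_mul, norm_mul, norm_pow, Real.norm_eq_abs]
      rw [Nat.abs_cast]
      push_cast
      ring
    have hcs := integral_mul_sq_le_of_hasCompactSupport
      (f := fun x => |u x| ^ (m + 1)) (g := fun x => ‖fderiv ℝ u x‖)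
      (hu.continuous.abs.pow _)
      (hus.comp_left (g := fun t : ℝ => |t| ^ (m + 1)) (by simp)) (fun x => by positivity)
      hcf.norm (hus.fderiv ℝ).norm (fun x => norm_nonneg _)
    have hpow : ∀ x, (|u x| ^ (m + 1)) ^ 2 = (u x ^ 2) ^ (m + 1) := fun x => by
      rw [← pow_mul, mul_comm, pow_mul, sq_abs]
    simp only [hpow] at hcs
    simp only [hfd, integral_const_mul] at hsob
    have hG : 0 ≤ ∫ x, ‖fderiv ℝ u x‖ ^ 2 := integral_nonneg fun x => sq_nonneg _
    calc ∫ x, (u x ^ 2) ^ (m + 1 + 1) = ∫ x, (u x ^ (m + 2)) ^ 2 := by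
          congr 1; ext x; rw [← pow_mul, ← pow_mul, mul_comm]
      _ ≤ (m + 2 : ℝ) ^ 2 * (∫ x, |u x| ^ (m + 1) * ‖fderiv ℝ u x‖) ^ 2 := by
          rw [← mul_pow]; exact hsob
      _ ≤ (m + 2 : ℝ) ^ 2 * ((((m + 1).factorial : ℝ) ^ 2 * (∫ x, u x ^ 2) *
            (∫ x, ‖fderiv ℝ u x‖ ^ 2) ^ m) * ∫ x, ‖fderiv ℝ u x‖ ^ 2) := by
          gcongr
          exact hcs.trans (mul_le_mul_of_nonneg_right ih hG)
      _ = _ := by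
          rw [Nat.factorial_succ (m + 1)]; push_cast; ring

lemma integral_mul_pow_le_holder (N : ℕ) {s r : (Fin 2 → ℝ) → ℝ}
    (hs : Continuous s) (hss : HasCompactSupport s) (hs0 : ∀ x, 0 ≤ s x)
    (hr : Continuous r) (hrs : HasCompactSupport r) (hr0 : ∀ x, 0 ≤ r x) :
    ∫ x, s x ^ (2 * N) * r x ≤
      ((((∫ x, s x ^ (2 * N + 1)) ^ (1 / (4 * (N : ℝ) + 2))) ^ (2 * N)) ^ 2) *
        (∫ x, r x ^ (2 * N + 1)) ^ (1 / (2 * (N : ℝ) + 1)) := by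
  rcases Nat.eq_zero_or_pos N with rfl | hN
  · simp
  have hN' : (0 : ℝ) < N := by exact_mod_cast hN
  have hpq : Real.HolderConjugate ((2 * (N : ℝ) + 1) / (2 * N)) (2 * (N : ℝ) + 1) := by
    rw [Real.holderConjugate_iff]
    constructor
    · rw [lt_div_iff₀ (by positivity)]; linarith
    · field_simp
  have h := integral_mul_le_Lp_mul_Lq_of_nonneg (μ := volume) hpq
    (f := fun x => s x ^ (2 * N)) (g := r)
    (.of_forall fun x => by have := hs0 x; positivity) (.of_forall hr0)
    ((hs.pow _).memLp_of_hasCompactSupport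
      (hss.comp_left (g := fun t : ℝ => t ^ (2 * N)) (by simp [hN.ne'])))
    (hr.memLp_of_hasCompactSupport hrs)
  have hP : 0 ≤ ∫ x, s x ^ (2 * N + 1) :=
    integral_nonneg fun x => pow_nonneg (hs0 x) _
  have h1 : ∀ x, (s x ^ (2 * N)) ^ ((2 * (N : ℝ) + 1) / (2 * N)) = s x ^ (2 * N + 1) := by
    intro x
    rw [← Real.rpow_natCast, ← Real.rpow_natCast, ← Real.rpow_mul (hs0 x)]
    congr 1
    push_cast
    field_simp
  have h2 : ∀ x, r x ^ (2 * (N : ℝ) + 1) = r x ^ (2 * N + 1) := by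
    intro x
    rw [← Real.rpow_natCast]; push_cast; rfl
  simp only [h1, h2] at h
  convert h using 2
  rw [← Real.rpow_natCast, ← Real.rpow_natCast, ← Real.rpow_mul hP, ← Real.rpow_mul hP]
  congr 1
  push_cast
  field_simp
  ring

lemma abs_sqrt_sub_sqrt_le (a b : Fin 2 → ℝ) :
    |√(∑ l, a l ^ 2) - √(∑ l, b l ^ 2)| ≤ √(∑ l, (a l - b l) ^ 2) := by
  have h := abs_norm_sub_norm_le (WithLp.toLp 2 a) (WithLp.toLp 2 b)
  simpa [EuclideanSpace.norm_eq] using h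

lemma abs_apply_le_sqrt_sum_sq (a : Fin 2 → ℝ) (k : Fin 2) : |a k| ≤ √(∑ l, a l ^ 2) :=
  Real.abs_le_sqrt
    (Finset.single_le_sum (f := fun l => a l ^ 2) (fun _ _ => sq_nonneg _) (Finset.mem_univ k))

lemma sq_pow_le_one_add_pow {t : ℝ} (ht : 0 ≤ t) {j N : ℕ} (hj : j ≤ N) :
    t ^ j ≤ 1 + t ^ N := by
  rcases le_total t 1 with h | h
  · have := pow_le_one₀ (n := j) ht h
    have := pow_nonneg ht N
    linarith
  · have := pow_le_pow_right₀ h hj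
    linarith

lemma abs_pow_mul_sub_pow_mul_le {j N : ℕ} (hj : j ≤ N) (a b : Fin 2 → ℝ) (k : Fin 2) :
    |(∑ l, a l ^ 2) ^ j * a k - (∑ l, b l ^ 2) ^ j * b k| ≤
      (2 * j + 1) * ((1 + (∑ l, a l ^ 2) ^ N + (∑ l, b l ^ 2) ^ N) *
        √(∑ l, (a l - b l) ^ 2)) := by
  have hS : 0 ≤ ∑ l, a l ^ 2 := Finset.sum_nonneg fun _ _ => sq_nonneg _
  have hT : 0 ≤ ∑ l, b l ^ 2 := Finset.sum_nonneg fun _ _ => sq_nonneg _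
  have hab := abs_sqrt_sub_sqrt_le a b
  have hk := abs_apply_le_sqrt_sum_sq (fun l => a l - b l) k
  have hbk := abs_apply_le_sqrt_sum_sq b k
  set α := √(∑ l, a l ^ 2) with hα
  set β := √(∑ l, b l ^ 2) with hβ
  set ρ := √(∑ l, (a l - b l) ^ 2) with hρ
  have hα0 : 0 ≤ α := Real.sqrt_nonneg _
  have hβ0 : 0 ≤ β := Real.sqrt_nonneg _
  have hρ0 : 0 ≤ ρ := Real.sqrt_nonneg _
  have hα2 : ∑ l, a l ^ 2 = α ^ 2 := (Real.sq_sqrt hS).symm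
  have hβ2 : ∑ l, b l ^ 2 = β ^ 2 := (Real.sq_sqrt hT).symm
  rw [hα2, hβ2]
  have hA := sq_pow_le_one_add_pow (sq_nonneg α) hj
  have hB := sq_pow_le_one_add_pow (sq_nonneg β) hj
  have hAN : 0 ≤ (α ^ 2) ^ N := by positivity
  have hBN : 0 ≤ (β ^ 2) ^ N := by positivity
  set W := 1 + (α ^ 2) ^ N + (β ^ 2) ^ N with hW
  have hmax : (max α β ^ 2) ^ j ≤ W := by
    rcases max_choice α β with h | h <;> rw [h] <;> linarith
  have hpow : |(α ^ 2) ^ j - (β ^ 2) ^ j| * β ≤ 2 * j * (W * ρ) := by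
    rcases Nat.eq_zero_or_pos j with rfl | hj0
    · simp
    have h := abs_pow_sub_pow_le α β (2 * j)
    rw [abs_of_nonneg hα0, abs_of_nonneg hβ0] at h
    rw [← pow_mul, ← pow_mul]
    calc |α ^ (2 * j) - β ^ (2 * j)| * β
        ≤ (|α - β| * ((2 * j : ℕ) : ℝ) * max α β ^ (2 * j - 1)) * max α β := by
          gcongr
          exact le_max_right _ _
      _ = |α - β| * (2 * j) * (max α β ^ 2) ^ j := by
          rw [← pow_mul, mul_assoc _ (_ ^ _) _, ← pow_succ]
          congr 2
          · push_cast; ring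
          · omega
      _ ≤ ρ * (2 * j) * W := by gcongr
      _ = _ := by ring
  calc |(α ^ 2) ^ j * a k - (β ^ 2) ^ j * b k|
      = |(α ^ 2) ^ j * (a k - b k) + ((α ^ 2) ^ j - (β ^ 2) ^ j) * b k| := by ring_nf
    _ ≤ |(α ^ 2) ^ j * (a k - b k)| + |((α ^ 2) ^ j - (β ^ 2) ^ j) * b k| := abs_add_le _ _
    _ = (α ^ 2) ^ j * |a k - b k| + |(α ^ 2) ^ j - (β ^ 2) ^ j| * |b k| := by
        rw [abs_mul, abs_mul, abs_of_nonneg (by positivity : 0 ≤ (α ^ 2) ^ j)]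
    _ ≤ W * ρ + |(α ^ 2) ^ j - (β ^ 2) ^ j| * β := by
        gcongr
        linarith
    _ ≤ W * ρ + 2 * j * (W * ρ) := by gcongr
    _ = _ := by ring

lemma abs_polyF_sub_polyF_le (N : ℕ) (b : Fin (N + 1) → ℝ) (hb : ∀ j, 0 < b j)
    (v w : Fin 2 → ℝ) (k : Fin 2) :
    |polyF N b v k - polyF N b w k| ≤ (∑ j : Fin (N + 1), b j * (2 * (j : ℕ) + 1)) *
      ((1 + (∑ l, v l ^ 2) ^ N + (∑ l, w l ^ 2) ^ N) * √(∑ l, (v l - w l) ^ 2)) := by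
  have h : polyF N b v k - polyF N b w k = ∑ j : Fin (N + 1),
      b j * ((∑ l, v l ^ 2) ^ (j : ℕ) * v k - (∑ l, w l ^ 2) ^ (j : ℕ) * w k) := by
    simp only [polyF, Finset.sum_mul, ← Finset.sum_sub_distrib]
    exact Finset.sum_congr rfl fun j _ => by ring
  rw [h, Finset.sum_mul]
  refine (Finset.abs_sum_le_sum_abs _ _).trans (Finset.sum_le_sum fun j _ => ?_)
  rw [abs_mul, abs_of_pos (hb j), mul_assoc]
  exact mul_le_mul_of_nonneg_left
    (abs_pow_mul_sub_pow_mul_le (Nat.lt_succ_iff.1 j.2) v w k) (hb j).le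

lemma sum_polyF_sub_sq_le (N : ℕ) (b : Fin (N + 1) → ℝ) (hb : ∀ j, 0 < b j)
    (v w : Fin 2 → ℝ) :
    ∑ k, (polyF N b v k - polyF N b w k) ^ 2 ≤
      6 * (∑ j : Fin (N + 1), b j * (2 * (j : ℕ) + 1)) ^ 2 *
        (∑ l, (v l - w l) ^ 2 + (∑ l, v l ^ 2) ^ (2 * N) * ∑ l, (v l - w l) ^ 2 +
          (∑ l, w l ^ 2) ^ (2 * N) * ∑ l, (v l - w l) ^ 2) := by
  have hk : ∀ k, (polyF N b v k - polyF N b w k) ^ 2 ≤ _ := fun k =>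
    sq_le_sq' (abs_le.1 (abs_polyF_sub_polyF_le N b hb v w k)).1
      (abs_le.1 (abs_polyF_sub_polyF_le N b hb v w k)).2
  have hR : 0 ≤ ∑ l, (v l - w l) ^ 2 := Finset.sum_nonneg fun _ _ => sq_nonneg _
  refine (Finset.sum_le_sum fun k _ => hk k).trans ?_
  rw [Finset.sum_const, Finset.card_univ, Fintype.card_fin, nsmul_eq_mul, mul_pow, mul_pow,
    Real.sq_sqrt hR, mul_comm 2 N, pow_mul, pow_mul]
  generalize (∑ l, v l ^ 2) ^ N = x
  generalize (∑ l, w l ^ 2) ^ N = y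
  generalize ∑ l, (v l - w l) ^ 2 = R at *
  generalize ∑ j : Fin (N + 1), b j * (2 * (j : ℕ) + 1 : ℝ) = L
  have h3 : (1 + x + y) ^ 2 ≤ 3 * (1 + x ^ 2 + y ^ 2) := by
    nlinarith [sq_nonneg (1 - x), sq_nonneg (1 - y), sq_nonneg (x - y)]
  calc ((2 : ℕ) : ℝ) * (L ^ 2 * ((1 + x + y) ^ 2 * R))
      ≤ ((2 : ℕ) : ℝ) * (L ^ 2 * ((3 * (1 + x ^ 2 + y ^ 2)) * R)) := by gcongr
    _ = _ := by push_cast; ring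

lemma integrable_comp_of_hasCompactSupport {w : (Fin 2 → ℝ) → (Fin 2 → ℝ)} (hw : Continuous w)
    (hws : HasCompactSupport w) {g : (Fin 2 → ℝ) → ℝ} (hg : Continuous g) (hg0 : g 0 = 0) :
    Integrable fun x => g (w x) :=
  Continuous.integrable_of_hasCompactSupport (hg.comp hw) (hws.comp_left hg0)

lemma contDiff_pderivE {u : (Fin 2 → ℝ) → ℝ} {m n : WithTop ℕ∞} (hu : ContDiff ℝ n u)
    (hmn : m + 1 ≤ n) (i : Fin 2) : ContDiff ℝ m (pderivE u i) :=
  (hu.fderiv_right hmn).clm_apply contDiff_const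

lemma hasCompactSupport_pderivE {u : (Fin 2 → ℝ) → ℝ} (hu : HasCompactSupport u) (i : Fin 2) :
    HasCompactSupport (pderivE u i) :=
  hu.fderiv_apply (𝕜 := ℝ) _

lemma rpow_half_sq {t : ℝ} (ht : 0 ≤ t) : (t ^ (1 / 2 : ℝ)) ^ 2 = t := by
  rw [← Real.sqrt_eq_rpow, Real.sq_sqrt ht]

lemma l2norm_sq (g : (Fin 2 → ℝ) → (Fin 2 → ℝ)) :
    l2norm g ^ 2 = ∫ x, ∑ k, g x k ^ 2 :=
  rpow_half_sq (integral_nonneg fun _ => Finset.sum_nonneg fun _ _ => sq_nonneg _)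

lemma lapNorm_sq (g : (Fin 2 → ℝ) → (Fin 2 → ℝ)) :
    lapNorm g ^ 2 = ∫ x, ∑ k, lapComp g k x ^ 2 :=
  rpow_half_sq (integral_nonneg fun _ => Finset.sum_nonneg fun _ _ => sq_nonneg _)

lemma gradNorm_sq (g : (Fin 2 → ℝ) → (Fin 2 → ℝ)) :
    gradNorm g ^ 2 = ∫ x, ∑ i, ∑ k, pderivE (fun y => g y k) i x ^ 2 :=
  rpow_half_sq (integral_nonneg fun _ =>
    Finset.sum_nonneg fun _ _ => Finset.sum_nonneg fun _ _ => sq_nonneg _)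

lemma integral_norm_fderiv_component_sq_le {w : (Fin 2 → ℝ) → (Fin 2 → ℝ)}
    (hw : ContDiff ℝ 1 w) (hws : HasCompactSupport w) (k : Fin 2) :
    ∫ x, ‖fderiv ℝ (fun y => w y k) x‖ ^ 2 ≤ 2 * gradNorm w ^ 2 := by
  have hc : ∀ k, ContDiff ℝ 1 fun y => w y k := fun k => contDiff_pi.1 hw k
  have hcs : ∀ k, HasCompactSupport fun y => w y k := fun k =>
    hws.comp_left (g := fun v : Fin 2 → ℝ => v k) rfl
  rw [gradNorm_sq, ← integral_const_mul]
  refine integral_mono_of_nonneg (.of_forall fun x => sq_nonneg _) ?_ (.of_forall fun x => ?_)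
  · refine Integrable.const_mul (integrable_finsetSum _ fun i _ =>
      integrable_finsetSum _ fun k _ => ?_) _
    refine Continuous.integrable_of_hasCompactSupport
      ((contDiff_pderivE (m := 0) (hc k) (by norm_num) i).continuous.pow 2) ?_
    exact (hasCompactSupport_pderivE (hcs k) i).comp_left (g := fun t : ℝ => t ^ 2)
      (zero_pow two_ne_zero)
  · refine (norm_fderiv_sq_le_sum_pderivE_sq _ x).trans ?_
    refine mul_le_mul_of_nonneg_left (Finset.sum_le_sum fun i _ => ?_) zero_le_two
    exact Finset.single_le_sum (f := fun k => pderivE (fun y => w y k) i x ^ 2)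
      (fun _ _ => sq_nonneg _) (Finset.mem_univ k)

/-- The Sobolev embedding `H¹(ℝ²) ⊂ L^{4N+2}(ℝ²)`. -/
lemma exists_sobolev_const (N : ℕ) : ∃ K > (0 : ℝ), ∀ w : (Fin 2 → ℝ) → (Fin 2 → ℝ),
    ContDiff ℝ 1 w → HasCompactSupport w →
      (∫ x, (∑ k, w x k ^ 2) ^ (2 * N + 1)) ^ (1 / (2 * (N : ℝ) + 1)) ≤
        K * (gradNorm w ^ 2 + l2norm w ^ 2) := by
  set K : ℝ := 2 ^ (4 * N + 1) * ((2 * N + 1).factorial : ℝ) ^ 2 with hK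
  have hK1 : 1 ≤ K :=
    one_le_mul_of_one_le_of_one_le (one_le_pow₀ one_le_two)
      (one_le_pow₀ (by exact_mod_cast Nat.factorial_pos _))
  refine ⟨K, by positivity, fun w hw hws => ?_⟩
  have hc : ∀ k, ContDiff ℝ 1 fun y => w y k := fun k => contDiff_pi.1 hw k
  have hcs : ∀ k, HasCompactSupport fun y => w y k := fun k =>
    hws.comp_left (g := fun v : Fin 2 → ℝ => v k) rfl
  have hA : ∀ k, ∫ x, w x k ^ 2 ≤ l2norm w ^ 2 := fun k => by
    rw [l2norm_sq]
    refine integral_mono_of_nonneg (.of_forall fun x => sq_nonneg _)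
      (integrable_comp_of_hasCompactSupport hw.continuous hws
        (g := fun v => ∑ k, v k ^ 2) (by fun_prop) (by simp)) (.of_forall fun x => ?_)
    exact Finset.single_le_sum (f := fun k => w x k ^ 2)
      (fun _ _ => sq_nonneg _) (Finset.mem_univ k)
  have hint : ∀ k, Integrable fun x => (w x k ^ 2) ^ (2 * N + 1) := fun k =>
    integrable_comp_of_hasCompactSupport hw.continuous hws
      (g := fun v => (v k ^ 2) ^ (2 * N + 1)) (by fun_prop) (by simp)
  have hcomp : ∀ k, ∫ x, (w x k ^ 2) ^ (2 * N + 1) ≤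
      ((2 * N + 1).factorial : ℝ) ^ 2 * l2norm w ^ 2 * (2 * gradNorm w ^ 2) ^ (2 * N) := fun k => by
    refine (integral_pow_even_le (hc k) (hcs k) (2 * N)).trans ?_
    have h0 : 0 ≤ ∫ x, ‖fderiv ℝ (fun y => w y k) x‖ ^ 2 := integral_nonneg fun _ => sq_nonneg _
    gcongr
    · exact hA k
    · exact integral_norm_fderiv_component_sq_le hw hws k
  have hsum : ∫ x, (∑ k, w x k ^ 2) ^ (2 * N + 1) ≤
      2 ^ (2 * N) * ∑ k, ∫ x, (w x k ^ 2) ^ (2 * N + 1) := by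
    rw [← integral_finsetSum _ fun k _ => hint k, ← integral_const_mul]
    refine integral_mono_of_nonneg
      (.of_forall fun x => pow_nonneg (Finset.sum_nonneg fun _ _ => sq_nonneg _) _)
      ((integrable_finsetSum _ fun k _ => hint k).const_mul _) (.of_forall fun x => ?_)
    simp only [Fin.sum_univ_two]
    exact add_pow_le (sq_nonneg _) (sq_nonneg _) (2 * N + 1)
  set G := gradNorm w ^ 2 with hG
  set A := l2norm w ^ 2 with hAdef
  have hG0 : 0 ≤ G := sq_nonneg _
  have hA0 : 0 ≤ A := sq_nonneg _
  have htot : ∫ x, (∑ k, w x k ^ 2) ^ (2 * N + 1) ≤ (K * (G + A)) ^ (2 * N + 1) := by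
    calc ∫ x, (∑ k, w x k ^ 2) ^ (2 * N + 1)
        ≤ 2 ^ (2 * N) * ∑ k : Fin 2,
            ((2 * N + 1).factorial : ℝ) ^ 2 * A * (2 * G) ^ (2 * N) :=
          hsum.trans (mul_le_mul_of_nonneg_left (Finset.sum_le_sum fun k _ => hcomp k)
            (by positivity))
      _ = K * (A * G ^ (2 * N)) := by
          rw [Fin.sum_univ_two, hK]; ring
      _ ≤ K ^ (2 * N + 1) * ((G + A) * (G + A) ^ (2 * N)) := by
          gcongr
          · exact le_self_pow₀ hK1 (by omega)
          · linarith
          · linarith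
      _ = _ := by rw [mul_pow K, ← pow_succ']
  have hbase : 0 ≤ ∫ x, (∑ k, w x k ^ 2) ^ (2 * N + 1) :=
    integral_nonneg fun x => pow_nonneg (Finset.sum_nonneg fun _ _ => sq_nonneg _) _
  calc (∫ x, (∑ k, w x k ^ 2) ^ (2 * N + 1)) ^ (1 / (2 * (N : ℝ) + 1))
      ≤ ((K * (G + A)) ^ (2 * N + 1)) ^ (1 / (2 * (N : ℝ) + 1)) :=
        Real.rpow_le_rpow hbase htot (by positivity)
    _ = K * (G + A) := by
        have := Real.pow_rpow_inv_natCast (x := K * (G + A)) (by positivity)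
          (n := 2 * N + 1) (by omega)
        push_cast at this
        rwa [one_div]

lemma continuous_polyF (N : ℕ) (b : Fin (N + 1) → ℝ) : Continuous (polyF N b) := by
  unfold polyF
  fun_prop

lemma integral_pow_mul_le_lqNorm (N : ℕ) {t w : (Fin 2 → ℝ) → (Fin 2 → ℝ)}
    (ht : Continuous t) (hts : HasCompactSupport t) (hw : Continuous w)
    (hws : HasCompactSupport w) :
    ∫ x, (∑ k, t x k ^ 2) ^ (2 * N) * ∑ k, w x k ^ 2 ≤
      (lqNorm N t ^ (2 * N)) ^ 2 *
        (∫ x, (∑ k, w x k ^ 2) ^ (2 * N + 1)) ^ (1 / (2 * (N : ℝ) + 1)) :=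
  integral_mul_pow_le_holder N (by fun_prop)
    (hts.comp_left (g := fun v : Fin 2 → ℝ => ∑ k, v k ^ 2) (by simp))
    (fun _ => Finset.sum_nonneg fun _ _ => sq_nonneg _) (by fun_prop)
    (hws.comp_left (g := fun v : Fin 2 → ℝ => ∑ k, v k ^ 2) (by simp))
    (fun _ => Finset.sum_nonneg fun _ _ => sq_nonneg _)

lemma lqNorm_nonneg (N : ℕ) (t : (Fin 2 → ℝ) → (Fin 2 → ℝ)) : 0 ≤ lqNorm N t :=
  Real.rpow_nonneg
    (integral_nonneg fun _ => pow_nonneg (Finset.sum_nonneg fun _ _ => sq_nonneg _) _) _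

lemma integrable_sum_polyF_sub_sq (N : ℕ) (b : Fin (N + 1) → ℝ)
    {t1 t2 : (Fin 2 → ℝ) → (Fin 2 → ℝ)} (h1 : Continuous t1) (h1s : HasCompactSupport t1)
    (h2 : Continuous t2) (h2s : HasCompactSupport t2) :
    Integrable fun x => ∑ k, (polyF N b (t1 x) k - polyF N b (t2 x) k) ^ 2 := by
  have hc1 := (continuous_polyF N b).comp h1
  have hc2 := (continuous_polyF N b).comp h2
  have hp0 : polyF N b 0 = 0 := by ext k; simp [polyF]
  refine Continuous.integrable_of_hasCompactSupport
    (continuous_finsetSum _ fun k _ =>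
      (((continuous_apply k).comp hc1).sub ((continuous_apply k).comp hc2)).pow 2) ?_
  exact ((h1s.comp_left hp0).sub (h2s.comp_left hp0)).comp_left
    (g := fun v : Fin 2 → ℝ => ∑ k, v k ^ 2) (by simp)

lemma integrable_sum_lapComp_sq {w : (Fin 2 → ℝ) → (Fin 2 → ℝ)}
    (hw : ContDiff ℝ 2 w) (hws : HasCompactSupport w) :
    Integrable fun x => ∑ k, lapComp w k x ^ 2 := by
  refine integrable_finsetSum _ fun k _ => ?_
  have hk : ContDiff ℝ 2 fun y => w y k := contDiff_pi.1 hw k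
  have hks : HasCompactSupport fun y => w y k :=
    hws.comp_left (g := fun v : Fin 2 → ℝ => v k) rfl
  have hc : ∀ i, Continuous (pderivE (pderivE (fun y => w y k) i) i) := fun i =>
    (contDiff_pderivE (m := 0) (contDiff_pderivE (m := 1) hk (by norm_num) i)
      (by norm_num) i).continuous
  have hs : ∀ i, HasCompactSupport (pderivE (pderivE (fun y => w y k) i) i) := fun i =>
    hasCompactSupport_pderivE (hasCompactSupport_pderivE hks i) i
  have hl : lapComp w k = pderivE (pderivE (fun y => w y k) 0) 0 +
      pderivE (pderivE (fun y => w y k) 1) 1 := by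
    ext x; simp [lapComp]
  refine Continuous.integrable_of_hasCompactSupport ?_ ?_
  · rw [hl]; exact ((hc 0).add (hc 1)).pow 2
  · have : HasCompactSupport (lapComp w k) := by rw [hl]; exact (hs 0).add (hs 1)
    exact this.comp_left (g := fun t : ℝ => t ^ 2) (zero_pow two_ne_zero)

lemma integral_sum_polyF_sub_sq_le (N : ℕ) (b : Fin (N + 1) → ℝ) (hb : ∀ j, 0 < b j) :
    ∃ C > (0 : ℝ), ∀ t1 t2 : (Fin 2 → ℝ) → (Fin 2 → ℝ),
      ContDiff ℝ 1 t1 → HasCompactSupport t1 → ContDiff ℝ 1 t2 → HasCompactSupport t2 →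
      ∫ x, ∑ k, (polyF N b (t1 x) k - polyF N b (t2 x) k) ^ 2 ≤
        C * (gradNorm (t1 - t2) ^ 2 + l2norm (t1 - t2) ^ 2) *
          (1 + lqNorm N t1 ^ (2 * N) + lqNorm N t2 ^ (2 * N)) ^ 2 := by
  obtain ⟨K, hK, hsob⟩ := exists_sobolev_const N
  set L : ℝ := ∑ j : Fin (N + 1), b j * (2 * (j : ℕ) + 1) with hL
  have hLpos : 0 < L :=
    Finset.sum_pos (fun j _ => mul_pos (hb j) (by positivity)) Finset.univ_nonempty
  refine ⟨6 * L ^ 2 * (1 + K), by positivity, fun t1 t2 h1 h1s h2 h2s => ?_⟩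
  have hw : ContDiff ℝ 1 (t1 - t2) := h1.sub h2
  have hws : HasCompactSupport (t1 - t2) := h1s.sub h2s
  have hR := integrable_comp_of_hasCompactSupport hw.continuous hws
    (g := fun v => ∑ k, v k ^ 2) (by fun_prop) (by simp)
  have hprod : ∀ t : (Fin 2 → ℝ) → (Fin 2 → ℝ), Continuous t →
      Integrable fun x => (∑ k, t x k ^ 2) ^ (2 * N) * ∑ k, (t1 - t2) x k ^ 2 := fun t ht => by
    have hwc := hw.continuous
    refine Continuous.integrable_of_hasCompactSupport (by fun_prop) ?_
    exact (hws.comp_left (g := fun v : Fin 2 → ℝ => ∑ k, v k ^ 2) (by simp)).mul_left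
  have hle : ∫ x, ∑ k, (polyF N b (t1 x) k - polyF N b (t2 x) k) ^ 2 ≤
      6 * L ^ 2 * (l2norm (t1 - t2) ^ 2 +
        (∫ x, (∑ k, t1 x k ^ 2) ^ (2 * N) * ∑ k, (t1 - t2) x k ^ 2) +
        ∫ x, (∑ k, t2 x k ^ 2) ^ (2 * N) * ∑ k, (t1 - t2) x k ^ 2) := by
    rw [l2norm_sq, ← integral_add' hR (hprod t1 h1.continuous),
      ← integral_add' (hR.add (hprod t1 h1.continuous)) (hprod t2 h2.continuous),
      ← integral_const_mul]
    refine integral_mono_of_nonneg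
      (.of_forall fun x => Finset.sum_nonneg fun _ _ => sq_nonneg _)
      (((hR.add (hprod t1 h1.continuous)).add (hprod t2 h2.continuous)).const_mul _)
      (.of_forall fun x => ?_)
    exact sum_polyF_sub_sq_le N b hb (t1 x) (t2 x)
  have hX := integral_pow_mul_le_lqNorm N h1.continuous h1s hw.continuous hws
  have hY := integral_pow_mul_le_lqNorm N h2.continuous h2s hw.continuous hws
  have hQ := hsob _ hw hws
  have hX0 : 0 ≤ lqNorm N t1 ^ (2 * N) := pow_nonneg (lqNorm_nonneg N t1) _
  have hY0 : 0 ≤ lqNorm N t2 ^ (2 * N) := pow_nonneg (lqNorm_nonneg N t2) _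
  have hG0 : 0 ≤ gradNorm (t1 - t2) ^ 2 := sq_nonneg _
  have hA0 : 0 ≤ l2norm (t1 - t2) ^ 2 := sq_nonneg _
  refine hle.trans ?_
  rw [mul_assoc (6 * L ^ 2), mul_assoc (6 * L ^ 2)]
  refine mul_le_mul_of_nonneg_left ?_ (by positivity)
  replace hX := hX.trans (mul_le_mul_of_nonneg_left hQ (sq_nonneg _))
  replace hY := hY.trans (mul_le_mul_of_nonneg_left hQ (sq_nonneg _))
  refine (add_le_add (add_le_add_right hX _) hY).trans ?_
  generalize lqNorm N t1 ^ (2 * N) = X at *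
  generalize lqNorm N t2 ^ (2 * N) = Y at *
  generalize gradNorm (t1 - t2) ^ 2 = G at *
  generalize l2norm (t1 - t2) ^ 2 = A at *
  have hXY : 1 + X ^ 2 + Y ^ 2 ≤ (1 + X + Y) ^ 2 := by nlinarith [mul_nonneg hX0 hY0]
  calc A + X ^ 2 * (K * (G + A)) + Y ^ 2 * (K * (G + A))
      ≤ (1 + K) * (G + A) * (1 + X ^ 2 + Y ^ 2) := by
        have e1 : 0 ≤ K * (G + A) := by positivity
        have e2 : 0 ≤ (G + A) * (X ^ 2 + Y ^ 2) := by positivity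
        nlinarith
    _ ≤ (1 + K) * (G + A) * (1 + X + Y) ^ 2 := by gcongr
    _ = _ := by ring

lemma abs_mul_le_mul_sq_add_sq_div {κ : ℝ} (hκ : 0 < κ) (d l : ℝ) :
    |d * l| ≤ κ * l ^ 2 + (4 * κ)⁻¹ * d ^ 2 := by
  have h : κ * l ^ 2 + (4 * κ)⁻¹ * d ^ 2 - |d| * |l| = κ * (|l| - (2 * κ)⁻¹ * |d|) ^ 2 := by
    rw [← sq_abs l, ← sq_abs d]
    field_simp
    ring
  rw [abs_mul]
  have := mul_nonneg hκ.le (sq_nonneg (|l| - (2 * κ)⁻¹ * |d|))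
  linarith

/-- estimate (2.18) of the paper:
`|∫ (f(θ₁) − f(θ₂))·Δ(θ₁−θ₂)| ≤ κ₂‖Δ(θ₁−θ₂)‖₂² + (C₁‖∇(θ₁−θ₂)‖₂² + C₂‖θ₁−θ₂‖₂²)(1 + ‖θ₁‖_{L^{4N+2}}^{2N} + ‖θ₂‖_{L^{4N+2}}^{2N})²`. -/
theorem polyF_laplacian_estimate (N : ℕ) (b : Fin (N + 1) → ℝ) (hb : ∀ j, 0 < b j) :
    ∀ κ₂ > (0:ℝ), ∃ C₁ > (0:ℝ), ∃ C₂ > (0:ℝ), ∀ t1 t2 : (Fin 2 → ℝ) → (Fin 2 → ℝ),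
      ContDiff ℝ (⊤ : ℕ∞) t1 → HasCompactSupport t1 →
      ContDiff ℝ (⊤ : ℕ∞) t2 → HasCompactSupport t2 →
      |∫ x : Fin 2 → ℝ, ∑ k : Fin 2,
          (polyF N b (t1 x) k - polyF N b (t2 x) k) * lapComp (t1 - t2) k x| ≤
        κ₂ * (lapNorm (t1 - t2)) ^ 2 +
          (C₁ * (gradNorm (t1 - t2)) ^ 2 + C₂ * (l2norm (t1 - t2)) ^ 2) *
            (1 + (lqNorm N t1) ^ (2 * N) + (lqNorm N t2) ^ (2 * N)) ^ 2 := by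
  intro κ hκ
  obtain ⟨C, hC, hest⟩ := integral_sum_polyF_sub_sq_le N b hb
  refine ⟨(4 * κ)⁻¹ * C, by positivity, (4 * κ)⁻¹ * C, by positivity,
    fun t1 t2 h1 h1s h2 h2s => ?_⟩
  have hone : (1 : WithTop ℕ∞) ≤ ((⊤ : ℕ∞) : WithTop ℕ∞) :=
    WithTop.coe_le_coe.2 (le_top : (1 : ℕ∞) ≤ ⊤)
  have htwo : (2 : WithTop ℕ∞) ≤ ((⊤ : ℕ∞) : WithTop ℕ∞) :=
    WithTop.coe_le_coe.2 (le_top : (2 : ℕ∞) ≤ ⊤)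
  have hd := integrable_sum_polyF_sub_sq N b h1.continuous h1s h2.continuous h2s
  have hl := integrable_sum_lapComp_sq ((h1.sub h2).of_le htwo) (h1s.sub h2s)
  have hbound := norm_integral_le_of_norm_le
    (f := fun x => ∑ k : Fin 2,
      (polyF N b (t1 x) k - polyF N b (t2 x) k) * lapComp (t1 - t2) k x)
    ((hl.const_mul κ).add (hd.const_mul (4 * κ)⁻¹)) (.of_forall fun x => by
      refine (Finset.abs_sum_le_sum_abs _ _).trans ?_
      simp only [Pi.add_apply, Finset.mul_sum, ← Finset.sum_add_distrib]
      exact Finset.sum_le_sum fun k _ => abs_mul_le_mul_sq_add_sq_div hκ _ _)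
  rw [integral_add' (hl.const_mul κ) (hd.const_mul _), integral_const_mul, integral_const_mul,
    ← lapNorm_sq, Real.norm_eq_abs] at hbound
  refine hbound.trans (add_le_add_right ?_ _)
  calc _ ≤ (4 * κ)⁻¹ * _ := mul_le_mul_of_nonneg_left
        (hest t1 t2 (h1.of_le hone) h1s (h2.of_le hone) h2s) (by positivity)
    _ = _ := by ring

end
end
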